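/- A rectangle R is contained in a simple polygon P (without holes) if and only if all four sides of R are contained in P. -/

import Mathlib

open Set Topology

/-- A nowhere vanishing continuous function on a real topological vector space has a continuous
logarithm. -/
theorem exists_continuous_exp_eq {X : Type*} [AddCommGroup X] [Module ℝ X] [TopologicalSpace X]
    [ContinuousAdd X] [ContinuousSMul ℝ X] [LocallyPathConnectedSpace X]
    {F : X → ℂ} (hF : Continuous F) (h0 : ∀ x, F x ≠ 0) :
    ∃ L : X → ℂ, Continuous L ∧ ∀ x, Complex.exp (L x) = F x := by
  obtain ⟨L, ⟨-, hL⟩, -⟩ := Complex.isCoveringMapOn_exp.existsUnique_continuousMap_lifts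
    (⟨F, hF⟩ : C(X, ℂ)) (a₀ := 0) (Complex.exp_log (h0 0)) h0
  exact ⟨L, L.continuous, fun x => congrFun hL x⟩

/-- Two continuous functions on a preconnected space with the same exponential which agree at one
point are equal. -/
theorem eq_of_exp_eq {X : Type*} [TopologicalSpace X] [PreconnectedSpace X] {g h : X → ℂ}
    (hg : Continuous g) (hh : Continuous h) (hexp : ∀ x, Complex.exp (g x) = Complex.exp (h x))
    (x₀ : X) (h₀ : g x₀ = h x₀) : g = h :=
  Complex.isCoveringMap_exp.eq_of_comp_eq hg hh
    (funext fun x => Subtype.ext (hexp x)) x₀ h₀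

/-- The function `(z - a) ^ k` has no continuous logarithm on a circle around `a` unless
`k = 0`. -/
theorem eq_zero_of_exp_eq_zpow_on_sphere {a : ℂ} {r : ℝ} (hr : 0 < r) {k : ℤ} {L : ℂ → ℂ}
    (hL : Continuous L)
    (h : ∀ z, dist z a = r → Complex.exp (L z) = (z - a) ^ k) : k = 0 := by
  have hcirc : ∀ t : ℝ, Complex.exp (L (circleMap a r t)) = (circleMap a r t - a) ^ k :=
    fun t => h _ (by simp [dist_eq_norm, abs_of_pos hr])
  have key := eq_of_exp_eq (X := ℝ) (g := fun t => L (circleMap a r t))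
    (h := fun t => L (circleMap a r 0) + k * (t * Complex.I))
    (hL.comp (continuous_circleMap a r)) (by fun_prop)
    (fun t => by
      simp only [Complex.exp_add, hcirc, Complex.exp_int_mul]
      simp [circleMap, mul_zpow]) 0 (by simp)
  have h2 := congrFun key (2 * Real.pi)
  have hper : circleMap a r (2 * Real.pi) = circleMap a r 0 := by
    simpa using periodic_circleMap a r 0
  simpa [hper, Real.pi_ne_zero] using h2

/-- **Borsuk's criterion**: if `A` is a bounded open set containing `a`, then `(z - a) ^ k` does
not extend from the frontier of `A` to a nonvanishing continuous function on the closure of `A`,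
unless `k = 0`. -/
theorem eq_zero_of_nonvanishing_extension {A : Set ℂ} (hA : IsOpen A)
    (hbdd : Bornology.IsBounded A) {a : ℂ} (ha : a ∈ A) {k : ℤ} {H : ℂ → ℂ}
    (hH : ContinuousOn H (closure A)) (hH0 : ∀ z ∈ closure A, H z ≠ 0)
    (hfr : ∀ z ∈ frontier A, H z = (z - a) ^ k) : k = 0 := by
  classical
  have hne : ∀ z ∉ A, z - a ≠ 0 := fun z hz h => hz (sub_eq_zero.1 h ▸ ha)
  set F : ℂ → ℂ := A.piecewise H fun z => (z - a) ^ k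
  have hF : Continuous F := by
    refine continuous_piecewise hfr hH ?_
    rw [hA.isClosed_compl.closure_eq]
    exact fun z hz => ((continuous_id.sub continuous_const).continuousAt.zpow₀ k
      (Or.inl (hne z hz))).continuousWithinAt
  have hF0 : ∀ z, F z ≠ 0 := by
    intro z
    by_cases hz : z ∈ A
    · simpa [F, hz] using hH0 z (subset_closure hz)
    · simpa [F, hz] using zpow_ne_zero k (hne z hz)
  obtain ⟨L, hL, hLF⟩ := exists_continuous_exp_eq hF hF0
  obtain ⟨r, hr, hAr⟩ := hbdd.subset_ball_lt 0 a
  refine eq_zero_of_exp_eq_zpow_on_sphere (a := a) hr hL fun z hz => ?_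
  have hzA : z ∉ A := fun h => (Metric.mem_ball.1 (hAr h)).ne hz
  simp [hLF, F, hzA]

/-- A function on the parameter interval of a simple closed curve with equal values at the
endpoints is induced by a continuous function on the whole space. -/
theorem exists_continuous_extension_of_simple_closed_curve {X : Type*} [TopologicalSpace X]
    [T4Space X] {f : ℝ → X} (hf : Continuous f) (hf01 : f 0 = f 1) (hinj : InjOn f (Ico 0 1))
    {γ : ℝ → ℂ} (hγ : Continuous γ) (hγ01 : γ 0 = γ 1) :
    ∃ G : X → ℂ, Continuous G ∧ ∀ t ∈ Icc (0 : ℝ) 1, G (f t) = γ t := by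
  have hC : IsClosed (f '' Icc (0 : ℝ) 1) := (isCompact_Icc.image hf).isClosed
  let q : C(Icc (0 : ℝ) 1, f '' Icc (0 : ℝ) 1) :=
    ⟨fun t => ⟨f t, mem_image_of_mem f t.2⟩, by fun_prop⟩
  have hq : IsQuotientMap q :=
    IsQuotientMap.of_surjective_continuous
      (by rintro ⟨_, t, ht, rfl⟩; exact ⟨⟨t, ht⟩, rfl⟩) q.continuous
  have hfib : ∀ s t : Icc (0 : ℝ) 1, q s = q t → γ s = γ t := by
    have reduce : ∀ t ∈ Icc (0 : ℝ) 1, ∃ t' ∈ Ico (0 : ℝ) 1, f t' = f t ∧ γ t' = γ t := by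
      intro t ht
      rcases ht.2.eq_or_lt with rfl | h
      · exact ⟨0, by simp, hf01, hγ01⟩
      · exact ⟨t, ⟨ht.1, h⟩, rfl, rfl⟩
    rintro ⟨s, hs⟩ ⟨t, ht⟩ hst
    obtain ⟨s', hs', hfs, hγs⟩ := reduce s hs
    obtain ⟨t', ht', hft, hγt⟩ := reduce t ht
    have : s' = t' := hinj hs' ht' (by rw [hfs, hft]; exact congrArg Subtype.val hst)
    change γ s = γ t
    rw [← hγs, ← hγt, this]
  let γ' : C(Icc (0 : ℝ) 1, ℂ) := ⟨fun t => γ t, by fun_prop⟩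
  obtain ⟨G, hG⟩ := (hq.lift γ' hfib).exists_restrict_eq hC
  refine ⟨G, G.continuous, fun t ht => ?_⟩
  have h1 := DFunLike.congr_fun hG (q ⟨t, ht⟩)
  have h2 := DFunLike.congr_fun (hq.lift_comp γ' hfib) ⟨t, ht⟩
  exact h1.trans h2

/-- If an integral combination of logarithms of `f - a` and `f - b` closes up along the simple
closed curve `f`, and `a`, but not `b`, is enclosed by a part of the curve, then the coefficient
of the logarithm of `f - a` vanishes. -/
theorem eq_zero_of_combination_closes {f : ℝ → ℂ} (hf : Continuous f) (hf01 : f 0 = f 1)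
    (hinj : InjOn f (Ico 0 1)) {A : Set ℂ} (hA : IsOpen A) (hbdd : Bornology.IsBounded A)
    (hfr : frontier A ⊆ f '' Icc 0 1) {a b : ℂ} (ha : a ∈ A) (hb : b ∉ closure A)
    {α β : ℝ → ℂ} (hα : Continuous α) (hβ : Continuous β)
    (hαf : ∀ t ∈ Icc (0 : ℝ) 1, Complex.exp (α t) = f t - a)
    (hβf : ∀ t ∈ Icc (0 : ℝ) 1, Complex.exp (β t) = f t - b) {k l : ℤ}
    (hkl : k * α 0 + l * β 0 = k * α 1 + l * β 1) : k = 0 := by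
  obtain ⟨G, hG, hGf⟩ := exists_continuous_extension_of_simple_closed_curve hf hf01 hinj
    (γ := fun t => k * α t + l * β t) (by fun_prop) hkl
  have hne : ∀ z ∈ closure A, z - b ≠ 0 := fun z hz h => hb (sub_eq_zero.1 h ▸ hz)
  refine eq_zero_of_nonvanishing_extension hA hbdd ha
    (H := fun z => Complex.exp (G z) * (z - b) ^ (-l)) ?_ ?_ ?_
  · exact fun z hz => ((Complex.continuous_exp.comp hG).continuousAt.mul
      ((continuous_id.sub continuous_const).continuousAt.zpow₀ _
        (Or.inl (hne z hz)))).continuousWithinAt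
  · exact fun z hz => mul_ne_zero (Complex.exp_ne_zero _) (zpow_ne_zero _ (hne z hz))
  · intro z hz
    have hzb := hne z (frontier_subset_closure hz)
    obtain ⟨t, ht, rfl⟩ := hfr hz
    simp only [hGf t ht, Complex.exp_add, Complex.exp_int_mul, hαf t ht, hβf t ht, mul_assoc,
      ← zpow_add₀ hzb]
    simp

/-- A continuous function on `[0, 1]` avoiding `a` has a continuous logarithm relative to `a`. -/
theorem exists_continuous_log_on_Icc {f : ℝ → ℂ} (hf : Continuous f) {a : ℂ}
    (ha : a ∉ f '' Icc 0 1) :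
    ∃ α : ℝ → ℂ, Continuous α ∧ ∀ t ∈ Icc (0 : ℝ) 1, Complex.exp (α t) = f t - a := by
  obtain ⟨α, hα, h⟩ := exists_continuous_exp_eq
    (F := fun t : ℝ => f (projIcc 0 1 zero_le_one t) - a)
    (by have := continuous_projIcc (α := ℝ) (h := zero_le_one (α := ℝ)); fun_prop)
    (fun t h => ha (sub_eq_zero.1 h ▸ mem_image_of_mem f (projIcc 0 1 zero_le_one t).2))
  exact ⟨α, hα, fun t ht => by rw [h, projIcc_of_mem _ ht]⟩

/-- The total change of a logarithm along a closed curve is an integral multiple of `2πi`. -/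
theorem exists_int_eq_add_of_exp_eq {f α : ℝ → ℂ} (hf01 : f 0 = f 1) {a : ℂ}
    (hα : ∀ t ∈ Icc (0 : ℝ) 1, Complex.exp (α t) = f t - a) :
    ∃ n : ℤ, α 1 = α 0 + n * (2 * Real.pi * Complex.I) :=
  Complex.exp_eq_exp_iff_exists_int.1 (by rw [hα 1 (by simp), hα 0 (by simp), hf01])

/-- Two disjoint nonempty bounded open sets in the plane cannot both have their frontiers contained
in a simple closed curve disjoint from them. -/
theorem false_of_two_regions {f : ℝ → ℂ} (hf : Continuous f) (hf01 : f 0 = f 1)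
    (hinj : InjOn f (Ico 0 1)) {A B : Set ℂ} (hA : IsOpen A) (hB : IsOpen B)
    (hAb : Bornology.IsBounded A) (hBb : Bornology.IsBounded B) (hAB : Disjoint A B)
    (hfA : frontier A ⊆ f '' Icc 0 1) (hfB : frontier B ⊆ f '' Icc 0 1) {a b : ℂ}
    (ha : a ∈ A) (hb : b ∈ B) (ha' : a ∉ f '' Icc 0 1) (hb' : b ∉ f '' Icc 0 1) : False := by
  obtain ⟨α, hα, hαf⟩ := exists_continuous_log_on_Icc hf ha'
  obtain ⟨β, hβ, hβf⟩ := exists_continuous_log_on_Icc hf hb'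
  obtain ⟨m, hm⟩ := exists_int_eq_add_of_exp_eq hf01 hαf
  obtain ⟨n, hn⟩ := exists_int_eq_add_of_exp_eq hf01 hβf
  have hbA : b ∉ closure A := disjoint_right.1 (hAB.closure_left hB) hb
  have haB : a ∉ closure B := disjoint_left.1 (hAB.closure_right hA) ha
  have hn0 : n = 0 := eq_zero_of_combination_closes hf hf01 hinj hA hAb hfA ha hbA hα hβ hαf hβf
    (k := n) (l := -m) (by rw [hm, hn]; push_cast; ring)
  exact one_ne_zero (eq_zero_of_combination_closes hf hf01 hinj hB hBb hfB hb haB hβ hα hβf hαf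
    (k := 1) (l := 0) (by rw [hm, hn, hn0]; simp))

theorem frontier_interior_sdiff_subset {X : Type*} [TopologicalSpace X] {R P : Set X}
    (hR : IsClosed R) (hP : IsClosed P) (h : frontier R ⊆ P) :
    frontier (interior R \ P) ⊆ frontier P := by
  rintro z ⟨hz, hz'⟩
  rw [(isOpen_interior.sdiff hP).interior_eq] at hz'
  have hzP : z ∈ P := by
    by_contra hzP
    have hzR : z ∈ R := closure_minimal (sdiff_subset.trans interior_subset) hR hz
    exact hzP (h ⟨subset_closure hzR, fun hi => hz' ⟨hi, hzP⟩⟩)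
  rw [frontier_eq_closure_inter_closure]
  exact ⟨subset_closure hzP, closure_mono (fun _ hx => hx.2) hz⟩

/-- A compact set whose frontier is a simple closed curve contains every compact set whose frontier
it contains. -/
theorem subset_of_frontier_subset {f : ℝ → ℂ} (hf : Continuous f) (hf01 : f 0 = f 1)
    (hinj : InjOn f (Ico 0 1)) {P R : Set ℂ} (hP : IsCompact P) (hint : (interior P).Nonempty)
    (hfP : f '' Icc 0 1 = frontier P) (hR : IsCompact R) (h : frontier R ⊆ P) : R ⊆ P := by
  intro b hb
  by_contra hbP
  obtain ⟨a, ha⟩ := hint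
  have hbR : b ∈ interior R := by
    by_contra hbi
    exact hbP (h ⟨subset_closure hb, hbi⟩)
  refine false_of_two_regions hf hf01 hinj isOpen_interior
    (isOpen_interior.sdiff hP.isClosed) (hP.isBounded.subset interior_subset)
    (hR.isBounded.subset (sdiff_subset.trans interior_subset))
    (disjoint_left.2 fun _ hx hx' => hx'.2 (interior_subset hx))
    (hfP ▸ frontier_interior_subset)
    (hfP ▸ frontier_interior_sdiff_subset hR.isClosed hP.isClosed h) ha ⟨hbR, hbP⟩ ?_ ?_
  · exact hfP ▸ fun h => h.2 ha
  · exact hfP ▸ fun h => hbP (hP.isClosed.frontier_subset h)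

/-- A (closed, nondegenerate) rectangle `R` is contained in a simple polygon `P` without holes
(a compact set whose frontier is a simple closed curve and which is the closure of its
interior) if and only if the boundary of `R` is contained in `P`. -/
theorem rectangle_in_polygon_iff_boundary (P : Set (ℝ × ℝ)) (hPcomp : IsCompact P)
    (hJordan : ∃ f : ℝ → ℝ × ℝ, Continuous f ∧ f 0 = f 1 ∧
      Set.InjOn f (Set.Ico (0 : ℝ) 1) ∧ f '' Set.Icc (0 : ℝ) 1 = frontier P)
    (hclos : P = closure (interior P))
    (p u v : ℝ × ℝ) (hu : u ≠ 0) (hv : v ≠ 0)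
    (huv : u.1 * v.1 + u.2 * v.2 = 0) :
    convexHull ℝ {p, p + u, p + v, p + u + v} ⊆ P ↔
      frontier (convexHull ℝ {p, p + u, p + v, p + u + v}) ⊆ P := by
  have hR : IsCompact (convexHull ℝ {p, p + u, p + v, p + u + v}) :=
    (Set.toFinite _).isCompact_convexHull ℝ
  refine ⟨hR.isClosed.frontier_subset.trans, fun h => ?_⟩
  obtain ⟨f, hf, hf01, hinj, hfP⟩ := hJordan
  have hint : (interior P).Nonempty := by
    rw [← closure_nonempty_iff, ← hclos]
    exact ⟨f 0, hPcomp.isClosed.frontier_subset (hfP ▸ mem_image_of_mem f (by simp))⟩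
  let e : ℝ × ℝ ≃ₜ ℂ := Complex.equivRealProdCLM.symm.toHomeomorph
  refine (image_subset_image_iff e.injective).1 ?_
  refine subset_of_frontier_subset (f := e ∘ f) (e.continuous.comp hf) (congrArg e hf01)
    (e.injective.comp_injOn hinj) (hPcomp.image e.continuous) ?_ ?_ (hR.image e.continuous) ?_
  · rw [← e.image_interior]
    exact hint.image e
  · rw [image_comp, hfP, e.image_frontier]
  · rw [← e.image_frontier]
    exact image_mono h
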